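/- arXiv:2506.05034 — 4 statements merged into one kernel-verified Lean document; each statement's English description precedes it below -/
import Mathlib

section
/- Suppose T assigns to every u ∈ S(ℝ²) and every t ≥ 0 a measurable function u^t : ℝ² → ℝ such that: (i) for every nondecreasing φ : ℝ → ℝ and every u ∈ S(ℝ²), (φ∘u)^t = φ∘(u^t) almost everywhere; (ii) for every nonnegative Lipschitz compactly supported function w and every t ≥ 0, the function w^t is Lipschitz with compact support and ∫_{ℝ²} |∇w^t|² dx ≤ ∫_{ℝ²} |∇w|² dx. Let u ∈ C¹(ℝ²) satisfy u(x) → −∞ as |x| → ∞, and let c₀ > c₁ be real constants. Then for every t ≥ 0: ∫_{ℝ²}|∇((u−c₀)₊)^t|² dx − ∫_{ℝ²}|∇(u−c₀)₊|² dx ≥ ∫_{ℝ²}|∇((u−c₁)₊)^t|² dx − ∫_{ℝ²}|∇(u−c₁)₊|² dx. -/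
open MeasureTheory Metric Set Filter

noncomputable section

/-- The plane `ℝ²`. -/
abbrev E2 : Type := EuclideanSpace ℝ (Fin 2)

/-- The class `S(ℝ²)`: measurable functions all of whose superlevel sets `{u > c}`
with `c > inf u` have finite Lebesgue measure. -/
def MemS (u : E2 → ℝ) : Prop :=
  Measurable u ∧ ∀ c : ℝ, (∃ x, u x < c) → volume {x | c < u x} < ⊤

theorem aux_integrable (f : E2 → ℝ) (K : NNReal) (hf : LipschitzWith K f)
    (hs : HasCompactSupport f) : Integrable (fun x => ‖gradient f x‖ ^ 2) := by
  have hn : ∀ x, ‖gradient f x‖ = ‖fderiv ℝ f x‖ := fun x => by simp [gradient]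
  simp_rw [hn]
  have hc : HasCompactSupport (fderiv ℝ f) := hs.fderiv ℝ
  have h0 : ∀ x, x ∉ tsupport f → ‖fderiv ℝ f x‖ ^ 2 = 0 := by
    intro x hx
    have : fderiv ℝ f x = 0 := by
      by_contra h
      exact hx (support_fderiv_subset ℝ h)
    simp [this]
  rw [← integrableOn_iff_integrable_of_support_subset (s := tsupport f)]
  · refine Measure.integrableOn_of_bounded (M := (K : ℝ) ^ 2) hs.isCompact.measure_lt_top.ne ?_ ?_
    · exact ((measurable_fderiv ℝ f).norm.pow_const 2).aestronglyMeasurable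
    · filter_upwards with x
      have := norm_fderiv_le_of_lipschitz ℝ hf (x₀ := x)
      rw [Real.norm_of_nonneg (by positivity)]
      gcongr
  · intro x hx
    by_contra h
    exact hx (h0 x h)

theorem aux_split (f : E2 → ℝ) (K : NNReal) (hf : LipschitzWith K f)
    (hs : HasCompactSupport f) (h : ℝ) (hh : 0 < h) :
    ∫ x, ‖gradient f x‖ ^ 2 = (∫ x, ‖gradient (fun y => min (f y) h) x‖ ^ 2) +
      ∫ x, ‖gradient (fun y => max (f y - h) 0) x‖ ^ 2 := by
  have hL1 : LipschitzWith K (fun y => min (f y) h) := hf.min_const h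
  have hL2 : LipschitzWith K (fun y => max (f y - h) 0) := by
    have : LipschitzWith K (fun y => f y - h) := by
      intro x y
      simpa using hf x y
    exact this.max_const 0
  have hS1 : HasCompactSupport (fun y => min (f y) h) :=
    hs.comp_left (g := fun s => min s h) (by simp [hh.le])
  have hS2 : HasCompactSupport (fun y => max (f y - h) 0) :=
    hs.comp_left (g := fun s => max (s - h) 0) (by simp [hh.le])
  rw [← integral_add (aux_integrable _ _ hL1 hS1) (aux_integrable _ _ hL2 hS2)]
  apply integral_congr_ae
  filter_upwards [hL1.ae_differentiableAt (μ := volume), hL2.ae_differentiableAt (μ := volume)]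
    with x h1 h2
  have hn : ∀ (g : E2 → ℝ) x, ‖gradient g x‖ = ‖fderiv ℝ g x‖ := fun g x => by simp [gradient]
  simp only [hn]
  have hsum : f = (fun y => min (f y) h) + (fun y => max (f y - h) 0) := by
    funext y
    simp only [Pi.add_apply]
    rcases le_total (f y) h with hy | hy
    · rw [min_eq_left hy, max_eq_right (by linarith)]; ring
    · rw [min_eq_right hy, max_eq_left (by linarith)]; ring
  have hfd : fderiv ℝ f x = fderiv ℝ (fun y => min (f y) h) x
      + fderiv ℝ (fun y => max (f y - h) 0) x := by
    conv_lhs => rw [hsum]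
    exact fderiv_add h1 h2
  rcases le_total (f x) h with hy | hy
  · have : fderiv ℝ (fun y => max (f y - h) 0) x = 0 := by
      apply IsLocalMin.fderiv_eq_zero
      apply Eventually.of_forall
      intro y
      simp [hy]
    rw [hfd, this]; simp
  · have : fderiv ℝ (fun y => min (f y) h) x = 0 := by
      apply IsLocalMax.fderiv_eq_zero
      apply Eventually.of_forall
      intro y
      simp [hy]
    rw [hfd, this]; simp

theorem aux_trunc (u : E2 → ℝ) (hu : ContDiff ℝ 1 u)
    (hbot : Tendsto u (cocompact E2) atBot) (c : ℝ) :
    (∃ K, LipschitzWith K (fun y => max (u y - c) 0)) ∧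
      HasCompactSupport (fun y => max (u y - c) 0) := by
  have h1 : ∀ᶠ x in cocompact E2, u x < c := hbot.eventually (eventually_lt_atBot c)
  obtain ⟨S, hS, hS'⟩ := mem_cocompact.1 h1
  obtain ⟨R, hR0, hR⟩ := hS.isBounded.subset_closedBall_lt 0 (0 : E2)
  let χ : ContDiffBump (0 : E2) := ⟨R, R + 1, hR0, by linarith⟩
  have hlt : ∀ x, x ∉ closedBall (0 : E2) R → u x < c := fun x hx =>
    hS' (fun h => hx (hR h))
  have hv : ContDiff ℝ 1 (fun y => χ y * (u y - c)) := χ.contDiff.mul (hu.sub contDiff_const)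
  have hvs : HasCompactSupport (fun y => χ y * (u y - c)) := χ.hasCompactSupport.mul_right
  have heq : (fun y => max (u y - c) 0) = fun y => max (χ y * (u y - c)) 0 := by
    funext y
    by_cases hy : y ∈ closedBall (0 : E2) R
    · rw [χ.one_of_mem_closedBall hy, one_mul]
    · have := hlt y hy
      rw [max_eq_right (by linarith), max_eq_right]
      exact mul_nonpos_of_nonneg_of_nonpos χ.nonneg (by linarith)
  rw [heq]
  obtain ⟨K, hK⟩ := hv.lipschitzWith_of_hasCompactSupport hvs (by simp)
  exact ⟨⟨K, hK.max_const 0⟩, hvs.comp_left (g := fun s => max s 0) (by simp)⟩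

/-- Monotonicity in the truncation level of the Dirichlet-energy deficit under an
abstract (continuous Steiner) symmetrization `T`: if `T` commutes a.e. with
nondecreasing composition on `S(ℝ²)` and does not increase the Dirichlet energy of
nonnegative Lipschitz compactly supported functions, then for `u ∈ C¹` with
`u(x) → −∞` as `|x| → ∞` and `c₀ > c₁`, the energy deficit of `(u−c₀)₊` dominates
that of `(u−c₁)₊` for every `t ≥ 0`. -/
theorem energy_deficit_monotone_in_truncation_level
    (T : (E2 → ℝ) → ℝ → (E2 → ℝ))
    -- (i) equivariance under nondecreasing composition, a.e. :
    (hcomp : ∀ u : E2 → ℝ, MemS u → ∀ φ : ℝ → ℝ, Monotone φ → ∀ t : ℝ, 0 ≤ t →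
      T (φ ∘ u) t =ᵐ[volume] φ ∘ (T u t))
    -- (ii) `T` preserves the class of nonnegative Lipschitz compactly supported
    -- functions and does not increase the Dirichlet energy :
    (henergy : ∀ w : E2 → ℝ, (∀ x, 0 ≤ w x) → (∃ K, LipschitzWith K w) →
      HasCompactSupport w → ∀ t : ℝ, 0 ≤ t →
        (∃ K', LipschitzWith K' (T w t)) ∧ HasCompactSupport (T w t) ∧
          ∫ x, ‖gradient (T w t) x‖ ^ 2 ≤ ∫ x, ‖gradient w x‖ ^ 2)
    (u : E2 → ℝ) (hu : ContDiff ℝ 1 u)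
    (hbot : Tendsto u (cocompact E2) atBot)
    (c₀ c₁ : ℝ) (hc : c₁ < c₀) :
    ∀ t : ℝ, 0 ≤ t →
      (∫ x, ‖gradient (T (fun y => max (u y - c₁) 0) t) x‖ ^ 2) -
          (∫ x, ‖gradient (fun y => max (u y - c₁) 0) x‖ ^ 2) ≤
        (∫ x, ‖gradient (T (fun y => max (u y - c₀) 0) t) x‖ ^ 2) -
          (∫ x, ‖gradient (fun y => max (u y - c₀) 0) x‖ ^ 2) := by
  intro t ht
  obtain ⟨⟨K, hK⟩, hS⟩ := aux_trunc u hu hbot c₁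
  set w : E2 → ℝ := fun y => max (u y - c₁) 0 with hw
  have hh : 0 < c₀ - c₁ := by linarith
  have hmem : MemS w := by
    refine ⟨hK.continuous.measurable, ?_⟩
    rintro c ⟨x, hx⟩
    have hc0 : 0 < c := lt_of_le_of_lt (le_max_right _ _) hx
    refine lt_of_le_of_lt (measure_mono ?_) hS.isCompact.measure_lt_top
    intro y hy
    apply subset_tsupport
    exact (hc0.trans hy).ne'
  have hw0 : (fun y => max (u y - c₀) 0) = (fun s => max (s - (c₀ - c₁)) 0) ∘ w := by
    funext y
    simp only [hw, Function.comp]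
    rcases le_total (u y - c₁) 0 with h | h
    · rw [max_eq_right h, max_eq_right, max_eq_right] <;> linarith
    · rw [max_eq_left h]; congr 1; ring
  have hm1 : Monotone (fun s : ℝ => max (s - (c₀ - c₁)) 0) := fun a b hab => by
    dsimp only; gcongr
  have hm2 : Monotone (fun s : ℝ => min s (c₀ - c₁)) := fun a b hab => by
    dsimp only; gcongr
  have e1 := hcomp w hmem _ hm1 t ht
  have e2 := hcomp w hmem _ hm2 t ht
  have hwn : ∀ x, 0 ≤ w x := fun x => le_max_right _ _
  obtain ⟨⟨K', hK'⟩, hS', -⟩ := henergy w hwn ⟨K, hK⟩ hS t ht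
  obtain ⟨⟨K0, hK0⟩, hS0⟩ := aux_trunc u hu hbot c₀
  obtain ⟨⟨K0', hK0'⟩, -, -⟩ := henergy _ (fun x => le_max_right _ _) ⟨K0, hK0⟩ hS0 t ht
  obtain ⟨⟨K2', hK2'⟩, -, hE⟩ := henergy ((fun s : ℝ => min s (c₀ - c₁)) ∘ w)
    (fun x => le_min (hwn x) hh.le) ⟨K, hK.min_const _⟩
    (hS.comp_left (g := fun s => min s (c₀ - c₁)) (by simp [hh.le])) t ht
  rw [hw0] at hK0' ⊢
  have E1 : T ((fun s => max (s - (c₀ - c₁)) 0) ∘ w) t =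
      (fun s => max (s - (c₀ - c₁)) 0) ∘ T w t :=
    (Continuous.ae_eq_iff_eq volume hK0'.continuous
      ((by fun_prop : Continuous fun s : ℝ => max (s - (c₀ - c₁)) 0).comp hK'.continuous)).1 e1
  have E2' : T ((fun s => min s (c₀ - c₁)) ∘ w) t = (fun s => min s (c₀ - c₁)) ∘ T w t :=
    (Continuous.ae_eq_iff_eq volume hK2'.continuous
      ((by fun_prop : Continuous fun s : ℝ => min s (c₀ - c₁)).comp hK'.continuous)).1 e2
  rw [E2'] at hE
  rw [E1, aux_split w K hK hS _ hh, aux_split (T w t) K' hK' hS' _ hh]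
  simp only [Function.comp_def] at hE ⊢
  linarith
end
end

section
/- Let ω₀ ∈ L^∞(ℝ²) have compact support with ω₀ not almost everywhere zero, let Ω ∈ ℝ satisfy Ω ≤ (1/2)·ess inf_{ℝ²} ω₀, and set u(x) = (N*ω₀)(x) + (Ω/2)|x|². Then there exists δ₀ ∈ ℝ such that for every c < δ₀: the level set {x ∈ ℝ² : u(x) = c} is a simple closed C¹ curve (the image of an injective continuously differentiable map from the unit circle with nowhere-vanishing derivative) whose bounded complementary component contains the origin, and the superlevel set {x ∈ ℝ² : u(x) > c} equals that bounded complementary component. -/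
open MeasureTheory Metric Set Filter

noncomputable section

/-- The Newtonian potential `N(x) = (1/(2π)) log(1/|x|)` on `ℝ²`. -/
def NewtonianPotential (x : E2) : ℝ := (1 / (2 * Real.pi)) * Real.log (1 / ‖x‖)

/-- The convolution `(N * ω)(x) = ∫ N(x-y) ω(y) dy`. -/
def newtonConv (ω : E2 → ℝ) (x : E2) : ℝ := ∫ y, NewtonianPotential (x - y) * ω y

/-- A simple closed `C¹` curve: the image of an injective continuously differentiable
(`2π`-periodic) map with nowhere-vanishing derivative. -/
def IsSimpleClosedC1Curve (L : Set E2) : Prop :=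
  ∃ γ : ℝ → E2, ContDiff ℝ 1 γ ∧ Function.Periodic γ (2 * Real.pi) ∧
    Set.InjOn γ (Set.Ico 0 (2 * Real.pi)) ∧ (∀ s, deriv γ s ≠ 0) ∧ L = Set.range γ


open scoped Topology

def unitVec (θ : ℝ) : E2 := !₂[Real.cos θ, Real.sin θ]

lemma unitVec_norm (θ : ℝ) : ‖unitVec θ‖ = 1 := by
  simp [unitVec, EuclideanSpace.norm_eq, Fin.sum_univ_two]

lemma unitVec_contDiff : ContDiff ℝ 1 unitVec := by
  rw [contDiff_euclidean]
  intro i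
  fin_cases i
  · simpa [unitVec] using Real.contDiff_cos
  · simpa [unitVec] using Real.contDiff_sin

lemma unitVec_periodic (θ : ℝ) : unitVec (θ + 2 * Real.pi) = unitVec θ := by
  simp [unitVec]

lemma unitVec_injOn : Set.InjOn unitVec (Set.Ico 0 (2 * Real.pi)) := by
  intro a ha b hb hab
  have h1 : Real.cos a = Real.cos b := by simpa [unitVec] using congrArg (fun v : E2 => v 0) hab
  have h2 : Real.sin a = Real.sin b := by simpa [unitVec] using congrArg (fun v : E2 => v 1) hab
  have h3 : (a : Real.Angle) = b := Real.Angle.cos_sin_inj h1 h2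
  rw [Real.Angle.angle_eq_iff_two_pi_dvd_sub] at h3
  obtain ⟨k, hk⟩ := h3
  have hp := Real.pi_pos
  have hk1 : (k : ℝ) < 1 := by
    have := ha.2; have := hb.1; nlinarith
  have hk2 : (-1 : ℝ) < k := by
    have := hb.2; have := ha.1; nlinarith
  have hk0 : k = 0 := by
    have : k < 1 := by exact_mod_cast hk1
    have : -1 < k := by exact_mod_cast hk2
    omega
  subst hk0
  simp at hk
  linarith

lemma exists_unitVec (x : E2) : ∃ θ, x = ‖x‖ • unitVec θ := by
  set z : ℂ := ⟨x 0, x 1⟩ with hz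
  have hn : ‖z‖ = ‖x‖ := by
    rw [Complex.norm_eq_sqrt_sq_add_sq, EuclideanSpace.norm_eq]
    simp [Fin.sum_univ_two, hz]
  refine ⟨z.arg, ?_⟩
  ext i
  fin_cases i
  · have := Complex.norm_mul_cos_arg z
    rw [hn] at this
    exact this.symm.trans (by simp [unitVec])
  · have := Complex.norm_mul_sin_arg z
    rw [hn] at this
    exact this.symm.trans (by simp [unitVec])

lemma isInvertible_real (L : ℝ →L[ℝ] ℝ) (h : L 1 ≠ 0) : L.IsInvertible := by
  refine ContinuousLinearMap.IsInvertible.of_inverse (g := (L 1)⁻¹ • ContinuousLinearMap.id ℝ ℝ) ?_ ?_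
  · ext; simp [h]
  · ext; simp [h]

lemma geom (u : E2 → ℝ) (u' : E2 → E2 →L[ℝ] ℝ) (R₀ R₁ κ B : ℝ) (h0 : 0 < R₀) (h01 : R₀ < R₁)
    (hκ : 0 < κ) (hd : ∀ x, R₀ < ‖x‖ → HasFDerivAt u (u' x) x)
    (hc : ContinuousOn u' {x | R₀ < ‖x‖})
    (hr : ∀ x, R₁ ≤ ‖x‖ → u' x x ≤ -κ) (hB : ∀ x, ‖x‖ ≤ R₁ → |u x| ≤ B) (c : ℝ) (hcB : c < -B) :
      IsSimpleClosedC1Curve {x | u x = c} ∧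
      c < u 0 ∧
      Bornology.IsBounded (connectedComponentIn {x | u x ≠ c} 0) ∧
      {x | c < u x} = connectedComponentIn {x | u x ≠ c} 0 := by
  have hR1 : 0 < R₁ := h0.trans h01
  have hopen : IsOpen {x : E2 | R₀ < ‖x‖} := isOpen_lt continuous_const continuous_norm
  have hcont : ContinuousOn u {x | R₀ < ‖x‖} := fun x hx => (hd x hx).continuousAt.continuousWithinAt
  have hlow : ∀ x, ‖x‖ ≤ R₁ → c < u x := fun x hx => by
    have := (abs_le.1 (hB x hx)).1; linarith
  have hfar : ∀ x, u x ≤ c → R₁ < ‖x‖ := fun x hx => by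
    by_contra h
    exact absurd (hlow x (not_lt.1 h)) (not_lt.2 hx)
  have hnorm : ∀ (e : E2) (t : ℝ), ‖e‖ = 1 → 0 < t → ‖t • e‖ = t := fun e t he ht => by
    rw [norm_smul, he, mul_one, Real.norm_of_nonneg ht.le]
  have hder : ∀ (e : E2) (t : ℝ), ‖e‖ = 1 → R₀ < t →
      HasDerivAt (fun t : ℝ => u (t • e)) (u' (t • e) e) t := fun e t he ht => by
    have h1 : HasDerivAt (fun t : ℝ => t • e) e t := by
      simpa using (hasDerivAt_id t).smul_const e
    exact (hd (t • e) (by rw [hnorm e t he (h0.trans ht)]; exact ht)).comp_hasDerivAt t h1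
  have hdle : ∀ (e : E2) (t : ℝ), ‖e‖ = 1 → R₁ ≤ t → u' (t • e) e ≤ -κ / t := fun e t he ht => by
    have ht0 := hR1.trans_le ht
    have := hr (t • e) (by rw [hnorm e t he ht0]; exact ht)
    rw [map_smul, smul_eq_mul] at this
    rw [le_div_iff₀ ht0]; linarith
  have hanti : ∀ e : E2, ‖e‖ = 1 → AntitoneOn (fun t => u (t • e) + κ * Real.log t) (Ici R₁) := by
    intro e he
    have hD : ∀ t, R₁ ≤ t → HasDerivAt (fun t => u (t • e) + κ * Real.log t)
        (u' (t • e) e + κ * t⁻¹) t := fun t ht =>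
      (hder e t he (h01.trans_le ht)).add ((Real.hasDerivAt_log (hR1.trans_le ht).ne').const_mul κ)
    apply antitoneOn_of_deriv_nonpos (convex_Ici _)
    · exact fun t ht => (hD t ht).continuousAt.continuousWithinAt
    · exact fun t ht => (hD t (interior_subset ht)).differentiableAt.differentiableWithinAt
    · intro t ht
      have ht' : R₁ ≤ t := interior_subset ht
      rw [(hD t ht').deriv]
      have := hdle e t he ht'
      rw [neg_div] at this
      rw [← div_eq_mul_inv]; linarith
  have hstrict : ∀ e : E2, ‖e‖ = 1 → StrictAntiOn (fun t : ℝ => u (t • e)) (Ici R₁) := by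
    intro e he s hs t ht hst
    have h1 := hanti e he hs ht hst.le
    have h2 := Real.log_lt_log (hR1.trans_le hs) hst
    simp only at h1 ⊢
    nlinarith
  -- upper bound
  have hup : ∀ x, R₁ ≤ ‖x‖ → u x ≤ B + κ * Real.log R₁ - κ * Real.log ‖x‖ := by
    intro x hx
    obtain ⟨θ, hθ⟩ := exists_unitVec x
    have h1 := hanti (unitVec θ) (unitVec_norm θ) (mem_Ici.2 le_rfl) (mem_Ici.2 hx) hx
    simp only [← hθ] at h1
    have h2 := (abs_le.1 (hB (R₁ • unitVec θ) (hnorm _ _ (unitVec_norm θ) hR1).le)).2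
    linarith
  have hex : ∀ θ, ∃ r, R₁ < r ∧ u (r • unitVec θ) = c := by
    intro θ
    obtain ⟨T, hT1, hT2⟩ : ∃ T, R₁ ≤ T ∧ u (T • unitVec θ) ≤ c := by
      have ht : Tendsto (fun t => κ * Real.log t) atTop atTop :=
        Real.tendsto_log_atTop.const_mul_atTop hκ
      obtain ⟨T, h1, h2⟩ := ((ht.eventually_ge_atTop (B + κ * Real.log R₁ - c)).and
        (eventually_ge_atTop R₁)).exists
      refine ⟨T, h2, ?_⟩
      have hn := hnorm _ _ (unitVec_norm θ) (hR1.trans_le h2)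
      have := hup (T • unitVec θ) (by rw [hn]; exact h2)
      rw [hn] at this
      linarith
    have hco : ContinuousOn (fun t : ℝ => u (t • unitVec θ)) (Icc R₁ T) := fun t ht =>
      (hder _ t (unitVec_norm θ) (h01.trans_le ht.1)).continuousAt.continuousWithinAt
    obtain ⟨r, hr1, hr2⟩ := intermediate_value_Icc' hT1 hco
      ⟨hT2, (hlow (R₁ • unitVec θ) (hnorm _ _ (unitVec_norm θ) hR1).le).le⟩
    refine ⟨r, ?_, hr2⟩
    have := hfar _ hr2.le
    rwa [hnorm _ _ (unitVec_norm θ) (hR1.trans_le hr1.1)] at this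
  choose r hr1 hr2 using hex
  have huniq : ∀ θ t, R₁ < t → u (t • unitVec θ) = c → t = r θ := fun θ t ht h =>
    (hstrict _ (unitVec_norm θ)).injOn (mem_Ici.2 ht.le) (mem_Ici.2 (hr1 θ).le) (h.trans (hr2 θ).symm)
  have hr0 : ∀ θ, 0 < r θ := fun θ => hR1.trans (hr1 θ)
  have hsm : ContDiff ℝ 1 r := by
    rw [contDiff_iff_contDiffAt]
    intro θ₀
    have hx0 : R₀ < ‖r θ₀ • unitVec θ₀‖ := by
      rw [hnorm _ _ (unitVec_norm θ₀) (hr0 θ₀)]; exact h01.trans (hr1 θ₀)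
    have hu1 : ContDiffAt ℝ 1 u (r θ₀ • unitVec θ₀) :=
      contDiffAt_one_iff.2 ⟨u', {x | R₀ < ‖x‖}, hopen.mem_nhds hx0, hc, hd⟩
    have hp : ContDiff ℝ 1 (fun p : ℝ × ℝ => p.2 • unitVec p.1) :=
      contDiff_snd.smul (unitVec_contDiff.comp contDiff_fst)
    have hf : ContDiffAt ℝ 1 (fun p : ℝ × ℝ => u (p.2 • unitVec p.1)) (θ₀, r θ₀) :=
      ContDiffAt.comp (θ₀, r θ₀) (g := u) hu1 hp.contDiffAt
    have hinv : (fderiv ℝ (fun p : ℝ × ℝ => u (p.2 • unitVec p.1)) (θ₀, r θ₀) ∘L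
        .inr ℝ ℝ ℝ).IsInvertible := by
      apply isInvertible_real
      have h1 : HasDerivAt (fun t : ℝ => ((θ₀, t) : ℝ × ℝ)) (0, 1) (r θ₀) :=
        (hasDerivAt_const _ _).prodMk (hasDerivAt_id _)
      have h2 := (hf.differentiableAt (by norm_num)).hasFDerivAt.comp_hasDerivAt (r θ₀) h1
      have h3 := hder _ (r θ₀) (unitVec_norm θ₀) (h01.trans (hr1 θ₀))
      have h4 := h2.unique h3
      have h5 := hdle _ (r θ₀) (unitVec_norm θ₀) (hr1 θ₀).le
      have h6 : -κ / r θ₀ < 0 := div_neg_of_neg_of_pos (by linarith) (hr0 θ₀)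
      simp only [ContinuousLinearMap.comp_apply, ContinuousLinearMap.inr_apply]
      rw [h4]
      exact (h5.trans_lt h6).ne
    have hψ := hf.contDiffAt_implicitFunction one_ne_zero hinv
    have hψ0 := hf.implicitFunction_apply_self one_ne_zero hinv
    have hψe := hf.eventually_apply_implicitFunction one_ne_zero hinv
    set ψ := hf.implicitFunction one_ne_zero hinv
    simp only at hψ hψ0 hψe
    refine hψ.congr_of_eventuallyEq ?_
    have hlt : ∀ᶠ θ in 𝓝 θ₀, R₁ < ψ θ :=
      hψ.continuousAt.eventually (lt_mem_nhds (by rw [hψ0]; exact hr1 θ₀))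
    filter_upwards [hlt, hψe] with θ h1 h2
    exact (huniq θ _ h1 (h2.trans (hr2 θ₀))).symm
  have hopen_lt : IsOpen {x | u x < c} := by
    have : {x | u x < c} = {x | R₀ < ‖x‖} ∩ u ⁻¹' (Iio c) := by
      ext x
      exact ⟨fun h => ⟨h01.trans (hfar x (le_of_lt h)), h⟩, fun h => h.2⟩
    rw [this]
    exact hcont.isOpen_inter_preimage hopen isOpen_Iio
  have hopen_gt : IsOpen {x | c < u x} := by
    have : {x | c < u x} = ball 0 R₁ ∪ ({x | R₀ < ‖x‖} ∩ u ⁻¹' (Ioi c)) := by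
      ext x
      constructor
      · intro h
        by_cases hx : ‖x‖ < R₁
        · left; simpa using hx
        · right; exact ⟨h01.trans_le (not_lt.1 hx), h⟩
      · rintro (h | h)
        · exact hlow x (by simpa using (mem_ball_zero_iff.1 h).le)
        · exact h.2
    rw [this]
    exact isOpen_ball.union (hcont.isOpen_inter_preimage hopen isOpen_Ioi)
  have h0c : c < u 0 := hlow 0 (by simpa using hR1.le)
  have hstar : StarConvex ℝ (0 : E2) {x | c < u x} := by
    rw [starConvex_zero_iff]
    intro x hx a ha0 ha1
    by_cases hax : ‖a • x‖ ≤ R₁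
    · exact hlow _ hax
    · push Not at hax
      obtain ⟨θ, hθ⟩ := exists_unitVec x
      have hn : ‖a • x‖ = a * ‖x‖ := by rw [norm_smul, Real.norm_of_nonneg ha0]
      have hle : a * ‖x‖ ≤ ‖x‖ := mul_le_of_le_one_left (norm_nonneg _) ha1
      rw [hn] at hax
      have := (hstrict _ (unitVec_norm θ)).antitoneOn (mem_Ici.2 hax.le)
        (mem_Ici.2 (hax.le.trans hle)) hle
      simp only [mul_smul, ← hθ] at this
      exact lt_of_lt_of_le hx this
  have heq : {x | c < u x} = connectedComponentIn {x | u x ≠ c} 0 := by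
    apply Subset.antisymm
    · exact (hstar.isPathConnected h0c).isConnected.isPreconnected.subset_connectedComponentIn
        h0c (fun x hx => ne_of_gt hx)
    · refine IsPreconnected.subset_left_of_subset_union hopen_gt hopen_lt ?_ ?_ ?_
        isPreconnected_connectedComponentIn
      · rw [Set.disjoint_left]
        intro x h1 h2
        exact lt_asymm (show c < u x from h1) h2
      · intro x hx
        rcases lt_or_gt_of_ne (connectedComponentIn_subset _ _ hx) with h | h
        · right; exact h
        · left; exact h
      · exact ⟨0, mem_connectedComponentIn (ne_of_gt h0c), h0c⟩
  refine ⟨?_, h0c, ?_, heq⟩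
  · refine ⟨fun θ => r θ • unitVec θ, hsm.smul unitVec_contDiff, ?_, ?_, ?_, ?_⟩
    · intro θ
      have : r (θ + 2 * Real.pi) = r θ := by
        apply huniq _ _ (hr1 _)
        rw [← unitVec_periodic θ]; exact hr2 _
      simp only [this, unitVec_periodic]
    · intro a ha b hb hab
      simp only at hab
      have hn : r a = r b := by
        have := congrArg norm hab
        rwa [hnorm _ _ (unitVec_norm a) (hr0 a), hnorm _ _ (unitVec_norm b) (hr0 b)] at this
      rw [hn] at hab
      exact unitVec_injOn ha hb (smul_right_injective E2 (hr0 b).ne' hab)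
    · intro s hs
      have hrd : HasDerivAt r (deriv r s) s := (hsm.differentiable (by norm_num) s).hasDerivAt
      have hγ : HasDerivAt (fun θ => r θ • unitVec θ) 0 s := by
        rw [← hs]
        exact ((hsm.smul unitVec_contDiff).differentiable (by norm_num) s).hasDerivAt
      have hi := fun i : Fin 2 =>
        (EuclideanSpace.proj i : E2 →L[ℝ] ℝ).hasFDerivAt.comp_hasDerivAt s hγ
      have e0 : HasDerivAt (fun θ => r θ * Real.cos θ) 0 s := by
        simpa [unitVec, Function.comp_def] using hi 0
      have e1 : HasDerivAt (fun θ => r θ * Real.sin θ) 0 s := by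
        simpa [unitVec, Function.comp_def] using hi 1
      have k0 := e0.unique (hrd.mul (Real.hasDerivAt_cos s))
      have k1 := e1.unique (hrd.mul (Real.hasDerivAt_sin s))
      have hcs := Real.sin_sq_add_cos_sq s
      have : r s = 0 := by
        linear_combination (-r s) * hcs + Real.sin s * k0 - Real.cos s * k1
      exact (hr0 s).ne' this
    · ext x
      constructor
      · intro hx
        obtain ⟨θ, hθ⟩ := exists_unitVec x
        refine ⟨θ, ?_⟩
        have : ‖x‖ = r θ := huniq θ _ (hfar x (le_of_eq hx)) (by rw [← hθ]; exact hx)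
        simp only [← this]
        exact hθ.symm
      · rintro ⟨θ, rfl⟩
        exact hr2 θ
  · rw [← heq]
    have ht : Tendsto (fun t => κ * Real.log t) atTop atTop :=
      Real.tendsto_log_atTop.const_mul_atTop hκ
    obtain ⟨T, hT⟩ := (eventually_atTop.1 (ht.eventually_ge_atTop (B + κ * Real.log R₁ - c)))
    apply (isBounded_closedBall (x := (0 : E2)) (r := max T R₁)).subset
    intro x hx
    rw [mem_closedBall_zero_iff]
    by_contra h
    push Not at h
    have h1 := hup x ((le_max_right _ _).trans h.le)
    have h2 := hT ‖x‖ ((le_max_left _ _).trans h.le)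
    have h3 : c < u x := hx
    linarith

lemma log_integrableOn (ρ : ℝ) :
    IntegrableOn (fun z : E2 => NewtonianPotential z) (ball (0 : E2) ρ) := by
  have h := integrableOn_fun_norm_addHaar (volume : Measure E2) (r := ρ)
    (f := fun t : ℝ => (1 / (2 * Real.pi)) * Real.log (1 / t))
  refine h.2 ?_
  have hc : Continuous (fun y : ℝ => -(1 / (2 * Real.pi)) * (y * Real.log y)) :=
    continuous_const.mul Real.continuous_mul_log
  have h2 : IntegrableOn (fun y : ℝ => -(1 / (2 * Real.pi)) * (y * Real.log y)) (Ioo 0 ρ) :=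
    (hc.integrableOn_Icc (a := 0) (b := ρ)).mono_set Ioo_subset_Icc_self
  refine h2.congr_fun ?_ measurableSet_Ioo
  intro y _
  simp
  ring

lemma newton_bound (ω : E2 → ℝ) (M R R₁ : ℝ) (hM : ∀ x, |ω x| ≤ M)
    (hω : ∀ y, R < ‖y‖ → ω y = 0) :
    ∃ B, ∀ x, ‖x‖ ≤ R₁ → |newtonConv ω x| ≤ B := by
  have hM0 : 0 ≤ M := (abs_nonneg _).trans (hM 0)
  set G : E2 → ℝ := (ball (0 : E2) (R₁ + R + 1)).indicator (fun z => M * |NewtonianPotential z|)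
    with hG
  have hGi : Integrable G := by
    rw [hG, integrable_indicator_iff measurableSet_ball]
    exact (log_integrableOn _).abs.const_mul M
  have hG0 : ∀ z, 0 ≤ G z := fun z => Set.indicator_nonneg (fun _ _ => by positivity) z
  refine ⟨∫ z, G z, fun x hx => ?_⟩
  rw [← integral_sub_left_eq_self G volume x]
  rw [newtonConv, ← Real.norm_eq_abs]
  refine norm_integral_le_of_norm_le (hGi.comp_sub_left x) (Eventually.of_forall fun y => ?_)
  by_cases hy : R < ‖y‖
  · simp only [hω y hy, mul_zero, norm_zero]
    exact hG0 _
  · have hin : x - y ∈ ball (0 : E2) (R₁ + R + 1) := by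
      rw [mem_ball_zero_iff]
      have := norm_sub_le x y
      linarith
    rw [hG, Set.indicator_of_mem hin, norm_mul, mul_comm]
    exact mul_le_mul_of_nonneg_right (hM y) (norm_nonneg _)

def newtonK (z : E2) : E2 →L[ℝ] ℝ := (-(1 / (2 * Real.pi)) * (‖z‖ ^ 2)⁻¹) • innerSL ℝ z

lemma newton_hasFDerivAt (z : E2) (hz : z ≠ 0) :
    HasFDerivAt NewtonianPotential (newtonK z) z := by
  have h1 := ((hasStrictFDerivAt_norm_sq z).hasFDerivAt.log
    (by positivity : ‖z‖ ^ 2 ≠ 0)).const_mul (-(1 / (4 * Real.pi)))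
  have h2 : NewtonianPotential = fun z : E2 => -(1 / (4 * Real.pi)) * Real.log (‖z‖ ^ 2) := by
    funext w
    simp only [NewtonianPotential, one_div, Real.log_inv, Real.log_pow]
    have := Real.pi_pos.ne'
    push_cast
    field_simp
    ring
  rw [h2]
  refine h1.congr_fderiv ?_
  ext v
  have := Real.pi_pos.ne'
  simp [newtonK]
  field_simp
  ring

lemma newtonK_norm (z : E2) (hz : 1 ≤ ‖z‖) : ‖newtonK z‖ ≤ 1 := by
  have hp := Real.pi_gt_three
  rw [newtonK, norm_smul, innerSL_apply_norm, norm_mul, norm_neg, norm_inv, norm_pow, norm_norm,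
    Real.norm_of_nonneg (by positivity)]
  have h0 : 0 < ‖z‖ := by linarith
  have : 1 / (2 * Real.pi) * (‖z‖ ^ 2)⁻¹ * ‖z‖ = 1 / (2 * Real.pi * ‖z‖) := by
    field_simp
  rw [this, div_le_one (by positivity)]
  nlinarith

lemma newtonK_continuousAt (z : E2) (hz : z ≠ 0) : ContinuousAt newtonK z := by
  unfold newtonK
  have h : ContinuousAt (fun z : E2 => -(1 / (2 * Real.pi)) * (‖z‖ ^ 2)⁻¹) z :=
    continuousAt_const.mul (ContinuousAt.inv₀ (by fun_prop) (by positivity))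
  exact h.smul (innerSL ℝ (E := E2)).continuous.continuousAt

lemma newtonK_measurable : Measurable newtonK := by
  unfold newtonK
  have h : Measurable fun z : E2 => -(1 / (2 * Real.pi)) * (‖z‖ ^ 2)⁻¹ := by fun_prop
  exact h.smul (innerSL ℝ (E := E2)).continuous.measurable

lemma newton_measurable : Measurable NewtonianPotential := by
  unfold NewtonianPotential
  fun_prop

lemma omega_integrable (ω : E2 → ℝ) (M R : ℝ) (hmeas : Measurable ω) (hM : ∀ x, |ω x| ≤ M)
    (hω : ∀ y, R < ‖y‖ → ω y = 0) : Integrable ω := by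
  have hi : Integrable ((closedBall (0 : E2) R).indicator fun _ => M) := by
    rw [integrable_indicator_iff measurableSet_closedBall]
    exact integrableOn_const measure_closedBall_lt_top.ne
  refine hi.mono' hmeas.aestronglyMeasurable (Eventually.of_forall fun y => ?_)
  by_cases hy : R < ‖y‖
  · simp [hω y hy, Set.indicator_of_notMem, hy]
  · rw [Set.indicator_of_mem (by simpa using hy)]
    exact hM y

lemma newton_F'_bound (ω : E2 → ℝ) (R : ℝ) (hω : ∀ y, R < ‖y‖ → ω y = 0) (x y : E2)
    (hx : R + 1 < ‖x‖) : ‖ω y • newtonK (x - y)‖ ≤ |ω y| := by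
  by_cases hy : R < ‖y‖
  · simp [hω y hy]
  · rw [norm_smul]
    refine mul_le_of_le_one_right (norm_nonneg _) (newtonK_norm _ ?_)
    have := norm_sub_norm_le x y
    linarith

lemma newton_F'_meas (ω : E2 → ℝ) (hmeas : Measurable ω) (x : E2) :
    AEStronglyMeasurable (fun y => ω y • newtonK (x - y)) volume :=
  (hmeas.smul (newtonK_measurable.comp (measurable_const.sub measurable_id))).aestronglyMeasurable

lemma newtonConv_hasFDerivAt (ω : E2 → ℝ) (M R : ℝ) (hmeas : Measurable ω) (hM : ∀ x, |ω x| ≤ M)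
    (hω : ∀ y, R < ‖y‖ → ω y = 0) (x : E2) (hx : R + 1 < ‖x‖) :
    HasFDerivAt (newtonConv ω) (∫ y, ω y • newtonK (x - y)) x := by
  have hi := omega_integrable ω M R hmeas hM hω
  have hFm : ∀ x, AEStronglyMeasurable (fun y => NewtonianPotential (x - y) * ω y) volume :=
    fun x => ((newton_measurable.comp (measurable_const.sub measurable_id)).mul
      hmeas).aestronglyMeasurable
  have hopen : IsOpen {x : E2 | R + 1 < ‖x‖} := isOpen_lt continuous_const continuous_norm
  refine hasFDerivAt_integral_of_dominated_of_fderiv_le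
    (F' := fun x y => ω y • newtonK (x - y)) (s := {x : E2 | R + 1 < ‖x‖})
    (bound := fun y => |ω y|) (hopen.mem_nhds hx) (Eventually.of_forall hFm) ?_
    (newton_F'_meas ω hmeas x) ?_ hi.abs ?_
  · refine (hi.abs.const_mul (‖x‖ + R)).mono' (hFm x) (Eventually.of_forall fun y => ?_)
    by_cases hy : R < ‖y‖
    · simp [hω y hy]
    · rw [norm_mul]
      refine mul_le_mul_of_nonneg_right ?_ (abs_nonneg _)
      have h1 := norm_sub_norm_le x y
      have h2 := norm_sub_le x y
      have h3 : 1 ≤ ‖x - y‖ := by linarith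
      have h4 := Real.log_nonneg h3
      have h5 := Real.log_le_self (by linarith : 0 ≤ ‖x - y‖)
      have hp := Real.pi_gt_three
      rw [NewtonianPotential, norm_mul, one_div ‖x - y‖, Real.log_inv, norm_neg,
        Real.norm_of_nonneg h4, Real.norm_of_nonneg (by positivity)]
      have : 1 / (2 * Real.pi) ≤ 1 := by
        rw [div_le_one (by positivity)]; linarith
      nlinarith
  · exact Eventually.of_forall fun y x hx => newton_F'_bound ω R hω x y hx
  · refine Eventually.of_forall fun y x hx => ?_
    by_cases hy : R < ‖y‖
    · simp only [hω y hy, mul_zero, zero_smul]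
      exact hasFDerivAt_const _ _
    · have hne : x - y ≠ 0 := by
        intro h
        have hx' : R + 1 < ‖x‖ := hx
        rw [sub_eq_zero] at h
        rw [h] at hx'
        linarith
      have h1 : HasFDerivAt (fun x => NewtonianPotential (x - y)) (newtonK (x - y)) x := by
        have := (newton_hasFDerivAt (x - y) hne).comp x ((hasFDerivAt_id x).sub_const y)
        rw [ContinuousLinearMap.comp_id] at this
        exact this
      exact h1.mul_const (ω y)

lemma newtonConv_deriv_cont (ω : E2 → ℝ) (M R : ℝ) (hmeas : Measurable ω) (hM : ∀ x, |ω x| ≤ M)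
    (hω : ∀ y, R < ‖y‖ → ω y = 0) :
    ContinuousOn (fun x => ∫ y, ω y • newtonK (x - y)) {x | R + 1 < ‖x‖} := by
  have hi := omega_integrable ω M R hmeas hM hω
  refine continuousOn_of_dominated (bound := fun y => |ω y|)
    (fun x _ => newton_F'_meas ω hmeas x)
    (fun x hx => Eventually.of_forall fun y => newton_F'_bound ω R hω x y hx) hi.abs
    (Eventually.of_forall fun y => ?_)
  by_cases hy : R < ‖y‖
  · simp only [hω y hy, zero_smul]
    exact continuousOn_const
  · intro x hx
    have hne : x - y ≠ 0 := by
      intro h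
      have hx' : R + 1 < ‖x‖ := hx
      rw [sub_eq_zero] at h
      rw [h] at hx'
      linarith
    have h1 : ContinuousAt (fun x => newtonK (x - y)) x :=
      ContinuousAt.comp (f := fun x => x - y) (g := newtonK) (newtonK_continuousAt _ hne)
        (by fun_prop)
    exact (h1.const_smul (ω y)).continuousWithinAt

lemma newtonConv_radial (ω : E2 → ℝ) (M R : ℝ) (hR : 0 ≤ R) (hmeas : Measurable ω)
    (hM : ∀ x, |ω x| ≤ M)
    (hω : ∀ y, R < ‖y‖ → ω y = 0) (x : E2) (hx : R + 1 < ‖x‖) :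
    (∫ y, ω y • newtonK (x - y)) x ≤
      -(1 / (2 * Real.pi)) * (∫ y, ω y) + R / (‖x‖ - R) * ∫ y, |ω y| := by
  have hi := omega_integrable ω M R hmeas hM hω
  have hFi : Integrable (fun y => ω y • newtonK (x - y)) :=
    hi.abs.mono' (newton_F'_meas ω hmeas x)
      (Eventually.of_forall fun y => newton_F'_bound ω R hω x y hx)
  rw [ContinuousLinearMap.integral_apply hFi, ← integral_const_mul, ← integral_const_mul,
    ← integral_add (hi.const_mul _) (hi.abs.const_mul _)]
  refine integral_mono (hFi.apply_continuousLinearMap x)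
    ((hi.const_mul _).add (hi.abs.const_mul _)) fun y => ?_
  by_cases hy : R < ‖y‖
  · simp [hω y hy]
  · push Not at hy
    have h1 := norm_sub_norm_le x y
    have h3 : 0 < ‖x - y‖ := by linarith
    have hin : inner ℝ (x - y) x = ‖x - y‖ ^ 2 + inner ℝ (x - y) y := by
      rw [← real_inner_self_eq_norm_sq, ← inner_add_right, sub_add_cancel]
    have hval : (ω y • newtonK (x - y)) x = -(1 / (2 * Real.pi)) * ω y
        + -(1 / (2 * Real.pi)) * ω y * (inner ℝ (x - y) y / ‖x - y‖ ^ 2) := by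
      simp only [newtonK, _root_.smul_apply, smul_eq_mul, innerSL_apply_apply, hin]
      field_simp
      ring
    simp only [hval]
    have hp := Real.pi_gt_three
    have h4 : |inner ℝ (x - y) y / ‖x - y‖ ^ 2| ≤ R / (‖x‖ - R) := by
      rw [abs_div, abs_of_nonneg (by positivity : 0 ≤ ‖x - y‖ ^ 2),
        div_le_div_iff₀ (by positivity) (by linarith)]
      have h5 := abs_real_inner_le_norm (x - y) y
      calc |inner ℝ (x - y) y| * (‖x‖ - R) ≤ (‖x - y‖ * R) * ‖x - y‖ := by
            refine mul_le_mul (h5.trans (by gcongr)) (by linarith) (by linarith) (by positivity)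
        _ = R * ‖x - y‖ ^ 2 := by ring
    have h6 : |-(1 / (2 * Real.pi)) * ω y| ≤ |ω y| := by
      rw [abs_mul, abs_neg, abs_of_nonneg (by positivity)]
      refine mul_le_of_le_one_left (abs_nonneg _) ?_
      rw [div_le_one (by positivity)]; linarith
    have h7 := mul_le_mul h4 h6 (abs_nonneg _) (div_nonneg hR (by linarith))
    rw [← abs_mul] at h7
    have h8 := (le_abs_self _).trans h7
    linarith

/-- Far-out level sets of the stream function `u = N*ω₀ + (Ω/2)|x|²` (with
`Ω ≤ (1/2) ess inf ω₀`, so `u` superharmonic) are simple closed `C¹` curves encircling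
the origin, and the corresponding superlevel set is the bounded complementary
component containing the origin. -/
theorem far_level_sets_are_simple_closed_curves
    (ω₀ : E2 → ℝ) (M : ℝ) (hmeas : Measurable ω₀) (hbound : ∀ x, |ω₀ x| ≤ M)
    (hsupp : HasCompactSupport ω₀) (hne : ¬ (ω₀ =ᵐ[volume] 0))
    (Ω : ℝ) (hΩ : Ω ≤ (1 / 2) * essInf ω₀ volume)
    (u : E2 → ℝ) (hu : u = fun x => newtonConv ω₀ x + Ω / 2 * ‖x‖ ^ 2) :
    ∃ δ₀ : ℝ, ∀ c < δ₀,
      IsSimpleClosedC1Curve {x | u x = c} ∧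
      c < u 0 ∧
      Bornology.IsBounded (connectedComponentIn {x | u x ≠ c} 0) ∧
      {x | c < u x} = connectedComponentIn {x | u x ≠ c} 0 := by
  have hbdd : IsBoundedUnder (· ≥ ·) (ae volume) ω₀ :=
    ⟨-M, eventually_map.2 (Eventually.of_forall fun x => (abs_le.1 (hbound x)).1)⟩
  have hess : ∀ᵐ y, essInf ω₀ volume ≤ ω₀ y := ae_essInf_le hbdd
  obtain ⟨R', hR'⟩ := hsupp.isCompact.isBounded.subset_closedBall (0 : E2)
  set R := max R' 0 with hRdef
  have hR : 0 ≤ R := le_max_right _ _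
  have hω : ∀ y, R < ‖y‖ → ω₀ y = 0 := by
    intro y hy
    by_contra h
    have := hR' (subset_tsupport _ h)
    rw [mem_closedBall_zero_iff] at this
    exact absurd hy (not_lt.2 (this.trans (le_max_left _ _)))
  have hess0 : essInf ω₀ volume ≤ 0 := by
    by_contra hpos
    push Not at hpos
    have hae : ∀ᵐ y : E2, y ∈ closedBall (0 : E2) R := by
      filter_upwards [hess] with y hy
      rw [mem_closedBall_zero_iff]
      by_contra h
      rw [hω y (not_le.1 h)] at hy
      linarith
    have h1 : volume (closedBall (0 : E2) R)ᶜ = 0 := hae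
    have h2 := measure_add_measure_compl (μ := volume) (measurableSet_closedBall (x := (0 : E2)) (ε := R))
    rw [h1, add_zero, measure_univ_of_isAddLeftInvariant] at h2
    exact measure_closedBall_lt_top.ne h2
  have hΩ0 : Ω ≤ 0 := by linarith
  have hi := omega_integrable ω₀ M R hmeas hbound hω
  set m := ∫ y, ω₀ y with hm
  set A := ∫ y, |ω₀ y| with hA
  have hA0 : 0 ≤ A := integral_nonneg fun y => abs_nonneg _
  have hpi := Real.pi_pos
  set u' : E2 → E2 →L[ℝ] ℝ := fun x => (∫ y, ω₀ y • newtonK (x - y)) + Ω • innerSL ℝ x with hu'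
  have hrad : ∀ x, R + 1 < ‖x‖ →
      u' x x ≤ -(1 / (2 * Real.pi)) * m + R / (‖x‖ - R) * A + Ω * ‖x‖ ^ 2 := by
    intro x hx
    have := newtonConv_radial ω₀ M R hR hmeas hbound hω x hx
    simp only [hu', _root_.add_apply, _root_.smul_apply, smul_eq_mul,
      innerSL_apply_apply, real_inner_self_eq_norm_sq]
    linarith
  obtain ⟨R₁, κ, hR₁, hκ, hr⟩ : ∃ R₁ κ : ℝ, R + 1 < R₁ ∧ 0 < κ ∧
      ∀ x, R₁ ≤ ‖x‖ → u' x x ≤ -κ := by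
    rcases hΩ0.lt_or_eq with hneg | hzero
    · refine ⟨max (R + 2) ((1 + R * A - (1 / (2 * Real.pi)) * m) / (-Ω)), 1,
        lt_of_lt_of_le (by linarith) (le_max_left _ _), one_pos, fun x hx => ?_⟩
      have h1 : R + 2 ≤ ‖x‖ := (le_max_left _ _).trans hx
      have h2 := (le_max_right _ _).trans hx
      rw [div_le_iff₀ (by linarith)] at h2
      have h3 := hrad x (by linarith)
      have h4 : R / (‖x‖ - R) * A ≤ R * A :=
        mul_le_mul_of_nonneg_right (div_le_self hR (by linarith)) hA0
      have h5 : ‖x‖ ≤ ‖x‖ ^ 2 := by nlinarith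
      nlinarith
    · have hnn : 0 ≤ᵐ[volume] ω₀ := by
        filter_upwards [hess] with y hy
        have : 0 ≤ essInf ω₀ volume := by linarith
        exact this.trans hy
      have hm0 : 0 < m := by
        refine lt_of_le_of_ne (integral_nonneg_of_ae hnn) fun h => hne ?_
        exact (integral_eq_zero_iff_of_nonneg_ae hnn hi).1 h.symm
      refine ⟨R + 2 + R * A * (4 * Real.pi) / m, m / (4 * Real.pi), ?_, by positivity,
        fun x hx => ?_⟩
      · have : 0 ≤ R * A * (4 * Real.pi) / m := by positivity
        linarith
      have h0 : 0 ≤ R * A * (4 * Real.pi) / m := by positivity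
      have h3 := hrad x (by linarith)
      rw [hzero, zero_mul, add_zero] at h3
      have h4 : R / (‖x‖ - R) * A ≤ m / (4 * Real.pi) := by
        rw [div_mul_eq_mul_div, div_le_div_iff₀ (by linarith) (by positivity)]
        have : R * A * (4 * Real.pi) / m ≤ ‖x‖ - R := by linarith
        rw [div_le_iff₀ hm0] at this
        linarith
      have h5 : -(1 / (2 * Real.pi)) * m = - (m / (4 * Real.pi)) - m / (4 * Real.pi) := by
        field_simp
        norm_num
      linarith
  obtain ⟨B, hB⟩ := newton_bound ω₀ M R R₁ hbound hω
  refine ⟨-(B + |Ω| / 2 * R₁ ^ 2), fun c hc => ?_⟩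
  refine geom u u' (R + 1) R₁ κ (B + |Ω| / 2 * R₁ ^ 2) (by linarith) hR₁ hκ ?_ ?_ hr ?_ c hc
  · intro x hx
    rw [hu]
    have h1 := newtonConv_hasFDerivAt ω₀ M R hmeas hbound hω x hx
    have h2 := (hasStrictFDerivAt_norm_sq x).hasFDerivAt.const_mul (Ω / 2)
    refine (h1.add h2).congr_fderiv ?_
    simp only [hu']
    congr 1
    ext v
    simp
    ring
  · exact (newtonConv_deriv_cont ω₀ M R hmeas hbound hω).add
      (((innerSL ℝ).continuous.const_smul Ω).continuousOn)
  · intro x hx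
    rw [hu]
    refine (abs_add_le _ _).trans (add_le_add (hB x hx) ?_)
    rw [abs_mul, abs_div, abs_of_pos (by norm_num : (0 : ℝ) < 2), abs_of_nonneg (by positivity : 0 ≤ ‖x‖ ^ 2)]
    gcongr
end
end

section
/- Let ω₀ ∈ L^∞(ℝ²) have compact support, let Ω < 0 satisfy Ω ≤ (1/2)·ess inf_{ℝ²} ω₀, and set u(x) = (N*ω₀)(x) + (Ω/2)|x|². Then there exists c* ∈ ℝ such that for every c < c*, the superlevel set {x ∈ ℝ² : u(x) > c} is a bounded convex open set. -/
open MeasureTheory Metric Set Filter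

noncomputable section

/-- Truncated logarithm. -/
def hT (s : ℝ) : ℝ := Real.log (max s 1) + min s 1 - 1

lemma hT_ge {s : ℝ} (hs : 1 ≤ s) : hT s = Real.log s := by
  simp [hT, max_eq_left hs, min_eq_right hs]

lemma hT_le {s : ℝ} (hs : s ≤ 1) : hT s = s - 1 := by
  simp [hT, max_eq_right hs, min_eq_left hs]

lemma hT_cont : Continuous hT := by
  unfold hT
  have : Continuous fun s : ℝ => Real.log (max s 1) := by
    apply Continuous.log (by fun_prop)
    intro x
    have : (1:ℝ) ≤ max x 1 := le_max_right _ _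
    linarith
  fun_prop

lemma hT_upper (a b : ℝ) (ha : 0 ≤ a) (hb : 0 ≤ b) :
    hT b ≤ hT a + (max a 1)⁻¹ * (b - a) := by
  rcases le_total 1 a with h1 | h1 <;> rcases le_total 1 b with h2 | h2
  · rw [hT_ge h1, hT_ge h2, max_eq_left h1]
    have ha' : 0 < a := by linarith
    have hb' : 0 < b := by linarith
    have := Real.log_le_sub_one_of_pos (div_pos hb' ha')
    rw [Real.log_div hb'.ne' ha'.ne'] at this
    have e : a⁻¹ * (b - a) = b / a - 1 := by field_simp
    linarith
  · rw [hT_ge h1, hT_le h2, max_eq_left h1]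
    have ha' : 0 < a := by linarith
    have := Real.one_sub_inv_le_log_of_pos ha'
    have e : a⁻¹ * (b - a) = b * a⁻¹ - 1 := by field_simp
    have : a⁻¹ ≤ 1 := inv_le_one_of_one_le₀ h1
    nlinarith
  · rw [hT_le h1, hT_ge h2, max_eq_right h1]
    have := Real.log_le_sub_one_of_pos (show 0 < b by linarith)
    simp; linarith
  · rw [hT_le h1, hT_le h2, max_eq_right h1]
    simp

lemma hT_lower (r ρ : ℝ) (hr : 0 ≤ r) (hρ : 0 ≤ ρ) :
    hT (r^2) + 2 * (max (r^2) 1)⁻¹ * (r * (ρ - r)) - 2 * (ρ - r)^2 ≤ hT (ρ^2) := by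
  rcases le_total 1 r with h1 | h1 <;> rcases le_total 1 ρ with h2 | h2
  · have h1' : 1 ≤ r^2 := by nlinarith
    have h2' : 1 ≤ ρ^2 := by nlinarith
    rw [hT_ge h1', hT_ge h2', max_eq_left h1']
    have ha' : 0 < r := by linarith
    have hb' : 0 < ρ := by linarith
    have := Real.one_sub_inv_le_log_of_pos (div_pos hb' ha')
    rw [Real.log_div hb'.ne' ha'.ne'] at this
    rw [Real.log_pow, Real.log_pow]
    have e : 2 * (r^2)⁻¹ * (r * (ρ - r)) = 2 * (1 - (ρ/r)⁻¹) + 2 * (r * ρ)⁻¹ * (ρ - r)^2 := by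
      field_simp; ring
    have : (r * ρ)⁻¹ ≤ 1 := inv_le_one_of_one_le₀ (by nlinarith)
    have := mul_le_mul_of_nonneg_right this (sq_nonneg (ρ - r))
    push_cast
    linarith
  · have h1' : 1 ≤ r^2 := by nlinarith
    have h2' : ρ^2 ≤ 1 := by nlinarith
    rw [hT_ge h1', hT_le h2', max_eq_left h1']
    have ha' : 0 < r := by linarith
    have := Real.log_le_sub_one_of_pos ha'
    rw [Real.log_pow]
    have e : 2 * (r^2)⁻¹ * (r * (ρ - r)) = 2 * ρ * r⁻¹ - 2 := by
      field_simp
    have h3 : 0 ≤ r⁻¹ * (3 * ρ^2 * r + 3 * r - 2 * r^2 - 2 * ρ + 2 * r^3 - 4 * ρ * r^2) := by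
      apply mul_nonneg (by positivity)
      nlinarith [pow_nonneg (sub_nonneg.2 h1) 3, mul_nonneg ha'.le (sq_nonneg (1 - ρ)),
        mul_nonneg (sub_nonneg.2 h2) (mul_nonneg (show 0 ≤ 2*r - 1 by linarith) (sub_nonneg.2 h1))]
    have e2 : r⁻¹ * (3 * ρ^2 * r + 3 * r - 2 * r^2 - 2 * ρ + 2 * r^3 - 4 * ρ * r^2)
      = 3 * ρ^2 + 3 - 2 * r - 2 * ρ * r⁻¹ + 2 * r^2 - 4 * ρ * r := by field_simp
    push_cast
    nlinarith
  · have h1' : r^2 ≤ 1 := by nlinarith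
    have h2' : 1 ≤ ρ^2 := by nlinarith
    rw [hT_le h1', hT_ge h2', max_eq_right h1']
    have hb' : 0 < ρ := by linarith
    have := Real.one_sub_inv_le_log_of_pos hb'
    rw [Real.log_pow]
    have h3 : 0 ≤ ρ⁻¹ * (2 * (ρ - 1)^3) := by
      apply mul_nonneg (by positivity)
      have := pow_nonneg (sub_nonneg.2 h2) 3
      linarith
    have e : ρ⁻¹ * (2 * (ρ - 1)^3) = 2 * ρ^2 - 6 * ρ + 6 - 2 * ρ⁻¹ := by field_simp; ring
    push_cast
    simp only [inv_one, mul_one]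
    nlinarith [mul_nonneg (sub_nonneg.2 h1) (sub_nonneg.2 h2), sq_nonneg (1 - r)]
  · have h1' : r^2 ≤ 1 := by nlinarith
    have h2' : ρ^2 ≤ 1 := by nlinarith
    rw [hT_le h1', hT_le h2', max_eq_right h1']
    simp only [inv_one, mul_one]
    nlinarith [sq_nonneg (ρ - r)]

/-- Regularized log kernel at scale `L`. -/
def kT (L : ℝ) (z : E2) : ℝ := Real.log L + (1/2) * hT ((‖z‖ / L)^2)

/-- Gradient of the regularized kernel. -/
def pT (L : ℝ) (z : E2) : E2 := ((max ((‖z‖ / L)^2) 1)⁻¹ * (L^2)⁻¹) • z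

lemma kT_cont (L : ℝ) : Continuous (kT L) := by
  unfold kT
  have := hT_cont
  fun_prop

lemma pT_cont (L : ℝ) : Continuous (pT L) := by
  unfold pT
  have : Continuous fun z : E2 => (max ((‖z‖ / L)^2) 1)⁻¹ := by
    apply Continuous.inv₀ (by fun_prop)
    intro x
    have : (1:ℝ) ≤ max ((‖x‖ / L)^2) 1 := le_max_right _ _
    linarith
  fun_prop

lemma kT_far {L : ℝ} (hL : 0 < L) {z : E2} (hz : L ≤ ‖z‖) : kT L z = Real.log ‖z‖ := by
  have h1 : 1 ≤ ‖z‖ / L := by rwa [one_le_div hL]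
  have h2 : 1 ≤ (‖z‖ / L)^2 := by nlinarith
  rw [kT, hT_ge h2, Real.log_pow, Real.log_div (by linarith) hL.ne']
  push_cast; ring

lemma kT_taylor {L : ℝ} (hL : 0 < L) (z w : E2) :
    |kT L w - kT L z - inner ℝ (pT L z) (w - z)| ≤ (L^2)⁻¹ * ‖w - z‖^2 := by
  have hz := norm_nonneg z
  have hw := norm_nonneg w
  have hin := real_inner_le_norm z w
  have e1 : ‖w - z‖^2 = ‖w‖^2 - 2 * inner ℝ z w + ‖z‖^2 := by
    rw [norm_sub_sq_real, real_inner_comm]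
  have e2 : inner ℝ (pT L z) (w - z) =
      (max ((‖z‖ / L)^2) 1)⁻¹ * (L^2)⁻¹ * (inner ℝ z w - ‖z‖^2) := by
    rw [pT, real_inner_smul_left, inner_sub_right, real_inner_self_eq_norm_sq]
  have hup := hT_upper ((‖z‖/L)^2) ((‖w‖/L)^2) (by positivity) (by positivity)
  have hlo := hT_lower (‖z‖/L) (‖w‖/L) (by positivity) (by positivity)
  have hm0 : 0 ≤ (max ((‖z‖ / L)^2) 1)⁻¹ := by positivity
  have hm1 : (max ((‖z‖ / L)^2) 1)⁻¹ ≤ 1 := inv_le_one_of_one_le₀ (le_max_right _ _)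
  have hi : 0 < (L^2)⁻¹ := by positivity
  rw [e2, e1]
  unfold kT
  generalize (max ((‖z‖ / L)^2) 1)⁻¹ = m at *
  generalize hT ((‖z‖ / L)^2) = A at *
  generalize hT ((‖w‖ / L)^2) = B at *
  simp only [div_eq_mul_inv] at *
  have e3 : (L⁻¹)^2 = (L^2)⁻¹ := by simp
  have hup' : B ≤ A + m * (L^2)⁻¹ * (‖w‖^2 - ‖z‖^2) := by
    rw [← e3]; linarith
  have hlo' : A + 2 * m * (L^2)⁻¹ * (‖z‖ * ‖w‖ - ‖z‖^2) - 2 * (L^2)⁻¹ * (‖w‖ - ‖z‖)^2 ≤ B := by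
    rw [← e3]; linarith
  generalize (L^2)⁻¹ = q at *
  generalize (inner ℝ z w : ℝ) = t at *
  have hd : 0 ≤ ‖w‖ ^ 2 - 2 * t + ‖z‖ ^ 2 := by rw [← e1]; positivity
  rw [abs_le]
  constructor
  · nlinarith [mul_nonneg (mul_nonneg hm0 hi.le) (sub_nonneg.2 hin), mul_nonneg hi.le (sub_nonneg.2 hin)]
  · nlinarith [mul_nonneg (mul_nonneg (sub_nonneg.2 hm1) hi.le) hd, mul_nonneg hi.le hd]

lemma int_smul {F : Type*} [NormedAddCommGroup F] [NormedSpace ℝ F]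
    (ω : E2 → ℝ) (M : ℝ) (hmeas : Measurable ω) (hbound : ∀ x, |ω x| ≤ M)
    (hsupp : HasCompactSupport ω) (f : E2 → F) (hf : Continuous f) :
    Integrable (fun y => ω y • f y) := by
  have hs : Function.support (fun y => ω y • f y) ⊆ tsupport ω := by
    intro y hy
    apply subset_tsupport
    intro h0
    apply hy
    simp [h0]
  rw [← integrableOn_iff_integrable_of_support_subset hs]
  have h1 : IntegrableOn f (tsupport ω) := hf.continuousOn.integrableOn_compact hsupp
  exact Integrable.bdd_smul h1 M hmeas.aestronglyMeasurable (Eventually.of_forall hbound)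

lemma W_taylor (ω : E2 → ℝ) (M : ℝ) (hmeas : Measurable ω) (hbound : ∀ x, |ω x| ≤ M)
    (hsupp : HasCompactSupport ω) {L : ℝ} (hL : 0 < L) (x x' : E2) :
    |(∫ y, ω y * kT L (x' - y)) - (∫ y, ω y * kT L (x - y))
      - inner ℝ (∫ y, ω y • pT L (x - y)) (x' - x)|
      ≤ (∫ y, |ω y|) * ((L^2)⁻¹ * ‖x' - x‖^2) := by
  have hk := kT_cont L
  have hp := pT_cont L
  have i1 : Integrable (fun y => ω y * kT L (x' - y)) :=
    int_smul ω M hmeas hbound hsupp (fun y => kT L (x' - y)) (by fun_prop)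
  have i2 : Integrable (fun y => ω y * kT L (x - y)) :=
    int_smul ω M hmeas hbound hsupp (fun y => kT L (x - y)) (by fun_prop)
  have i3 : Integrable (fun y => ω y • pT L (x - y)) :=
    int_smul ω M hmeas hbound hsupp (fun y => pT L (x - y)) (by fun_prop)
  have i4 : Integrable ω := by
    simpa using int_smul ω M hmeas hbound hsupp (fun _ => (1:ℝ)) (by fun_prop)
  have i5 : Integrable (fun y => inner ℝ (x' - x) (ω y • pT L (x - y))) := i3.const_inner _
  have i6 : Integrable (fun y => ω y * kT L (x' - y) - ω y * kT L (x - y)) := i1.sub i2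
  rw [real_inner_comm, ← integral_inner i3, ← integral_sub i1 i2, ← integral_sub i6 i5,
    ← integral_mul_const, ← Real.norm_eq_abs]
  refine norm_integral_le_of_norm_le (i4.abs.mul_const _) (Eventually.of_forall fun y => ?_)
  have h := kT_taylor hL (x - y) (x' - y)
  have e : x' - y - (x - y) = x' - x := by abel
  rw [e] at h
  have e2 : ω y * kT L (x' - y) - ω y * kT L (x - y) - inner ℝ (x' - x) (ω y • pT L (x - y))
    = ω y * (kT L (x' - y) - kT L (x - y) - inner ℝ (pT L (x - y)) (x' - x)) := by
    rw [real_inner_comm, real_inner_smul_left]; ring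
  rw [Real.norm_eq_abs]
  rw [e2, abs_mul]
  gcongr

lemma newton_eq (z : E2) : NewtonianPotential z = -(1 / (2 * Real.pi)) * Real.log ‖z‖ := by
  rw [NewtonianPotential, one_div ‖z‖, Real.log_inv]; ring

lemma log_int (R : ℝ) : IntegrableOn (fun z : E2 => |NewtonianPotential z|) (ball 0 R) := by
  have h : IntegrableOn (fun z : E2 => Real.log ‖z‖) (ball 0 R) := by
    rw [integrableOn_fun_norm_addHaar volume (f := Real.log)]
    simp only [finrank_euclideanSpace, Fintype.card_fin, smul_eq_mul]
    norm_num
    exact (Real.continuous_mul_log.continuousOn.integrableOn_compact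
      (isCompact_Icc (a := 0) (b := R))).mono_set Ioo_subset_Icc_self
  have := (h.const_mul (-(1 / (2 * Real.pi)))).abs
  simp only [newton_eq]
  exact this

lemma newton_bdd (ω : E2 → ℝ) (M : ℝ) (hbound : ∀ x, |ω x| ≤ M) (R : ℝ)
    (hR : ∀ y, ω y ≠ 0 → ‖y‖ ≤ R) (R1 : ℝ) :
    ∃ C : ℝ, ∀ x, ‖x‖ ≤ R1 → |newtonConv ω x| ≤ C := by
  set g : E2 → ℝ := (ball (0:E2) (R + R1 + 1)).indicator (fun z => |NewtonianPotential z|) with hg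
  have gi : Integrable g := by
    rw [hg, integrable_indicator_iff measurableSet_ball]
    exact log_int _
  refine ⟨∫ z, g z * M, fun x hx => ?_⟩
  rw [← integral_sub_left_eq_self _ volume x, newtonConv, ← Real.norm_eq_abs]
  refine norm_integral_le_of_norm_le ((gi.mul_const M).comp_sub_left x)
    (Eventually.of_forall fun y => ?_)
  rw [Real.norm_eq_abs, abs_mul]
  have hM : 0 ≤ M := (abs_nonneg _).trans (hbound 0)
  have hg0 : ∀ z, 0 ≤ g z := fun z => indicator_nonneg (fun _ _ => abs_nonneg _) z
  by_cases h : ω y = 0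
  · simp only [h, abs_zero, mul_zero]
    exact mul_nonneg (hg0 _) hM
  · have hy := hR y h
    have hm : x - y ∈ ball (0:E2) (R + R1 + 1) := by
      rw [mem_ball_zero_iff]
      have := norm_sub_le x y
      linarith
    simp only [hg, indicator_of_mem hm]
    gcongr
    exact hbound y

/-- For `Ω < 0` with `Ω ≤ (1/2) ess inf ω₀`, the far-out superlevel sets of the stream
function `u = N*ω₀ + (Ω/2)|x|²` are bounded convex open sets. -/
theorem far_superlevel_sets_are_convex
    (ω₀ : E2 → ℝ) (M : ℝ) (hmeas : Measurable ω₀) (hbound : ∀ x, |ω₀ x| ≤ M)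
    (hsupp : HasCompactSupport ω₀)
    (Ω : ℝ) (hΩneg : Ω < 0) (hΩ : Ω ≤ (1 / 2) * essInf ω₀ volume)
    (u : E2 → ℝ) (hu : u = fun x => newtonConv ω₀ x + Ω / 2 * ‖x‖ ^ 2) :
    ∃ cstar : ℝ, ∀ c < cstar,
      Bornology.IsBounded {x | c < u x} ∧ Convex ℝ {x | c < u x} ∧ IsOpen {x | c < u x} := by
  have hmain : ∃ (w : E2 → ℝ) (V : E2 → E2) (ε R1 : ℝ), 0 < ε ∧
      (∀ x x', w x' ≤ w x + inner ℝ (V x) (x' - x) - ε * ‖x' - x‖^2) ∧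
      (∀ x, R1 ≤ ‖x‖ → u x = w x) ∧ (∃ C, ∀ x, ‖x‖ ≤ R1 → C ≤ u x) := by
    obtain ⟨R, hR⟩ : ∃ R, ∀ y, ω₀ y ≠ 0 → ‖y‖ ≤ R := by
      obtain ⟨R, hR⟩ := hsupp.isBounded.exists_norm_le
      exact ⟨R, fun y hy => hR y (subset_tsupport _ hy)⟩
    set A : ℝ := ∫ y, |ω₀ y| with hA
    have hA0 : 0 ≤ A := integral_nonneg fun _ => abs_nonneg _
    have hpi := Real.pi_pos
    set k : ℝ := 1 / (2 * Real.pi) with hk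
    have hk0 : 0 < k := by positivity
    obtain ⟨L, hL1, hLA⟩ : ∃ L : ℝ, 1 ≤ L ∧ k * (A * (L^2)⁻¹) ≤ -Ω / 4 := by
      refine ⟨1 + k * A * (4 / (-Ω)), ?_, ?_⟩
      · have : 0 ≤ k * A * (4 / (-Ω)) := by
          have : 0 < -Ω := by linarith
          positivity
        linarith
      · have hO : 0 < -Ω := by linarith
        have ht : 0 ≤ k * A * (4 / (-Ω)) := by positivity
        have e : k * A = (k * A * (4 / (-Ω))) * (-Ω / 4) := by
          have hO' : Ω ≠ 0 := hΩneg.ne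
          field_simp
        generalize k * A * (4 / (-Ω)) = t at *
        rw [← mul_assoc, e, ← div_eq_mul_inv, div_le_iff₀ (by positivity)]
        nlinarith [mul_nonneg hO.le (sq_nonneg t), mul_nonneg hO.le ht]
    have hL : 0 < L := by linarith
    refine ⟨fun x => -k * (∫ y, ω₀ y * kT L (x - y)) + Ω / 2 * ‖x‖^2,
      fun x => -k • (∫ y, ω₀ y • pT L (x - y)) + Ω • x, -Ω/4, R + L, by linarith, ?_, ?_, ?_⟩
    · intro x x'
      have h := W_taylor ω₀ M hmeas hbound hsupp hL x x'
      have h' := (abs_le.1 h).1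
      have e1 : ‖x'‖^2 = ‖x‖^2 + 2 * inner ℝ x (x' - x) + ‖x' - x‖^2 := by
        rw [← norm_add_sq_real]; congr 2; abel
      simp only [inner_add_left, real_inner_smul_left]
      rw [e1]
      have h2 := mul_le_mul_of_nonneg_left h' hk0.le
      have h3 := mul_le_mul_of_nonneg_right hLA (sq_nonneg ‖x' - x‖)
      rw [← hA] at h2
      nlinarith
    · intro x hx
      rw [hu]
      simp only
      congr 1
      rw [newtonConv, ← integral_const_mul]
      congr 1
      ext y
      by_cases h : ω₀ y = 0
      · simp [h]
      · have hy := hR y h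
        have : L ≤ ‖x - y‖ := by
          have := norm_sub_norm_le x y
          linarith
        rw [newton_eq, kT_far hL this]; ring
    · obtain ⟨C, hC⟩ := newton_bdd ω₀ M hbound R hR (R + L)
      refine ⟨-C + Ω / 2 * (R + L)^2, fun x hx => ?_⟩
      have h1 := (abs_le.1 (hC x hx)).1
      have h2 : ‖x‖^2 ≤ (R+L)^2 := by
        have := norm_nonneg x
        gcongr
      rw [hu]
      simp only
      nlinarith
  obtain ⟨w, V, ε, R1, hε, hw, hfar, C, hC⟩ := hmain
  have hconc : ConcaveOn ℝ univ w := by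
    refine ⟨convex_univ, fun x _ y _ a b ha hb hab => ?_⟩
    set z := a • x + b • y with hz
    have h1 := hw z x
    have h2 := hw z y
    have e : a * inner ℝ (V z) (x - z) + b * inner ℝ (V z) (y - z) = 0 := by
      rw [← real_inner_smul_right, ← real_inner_smul_right, ← inner_add_right]
      have : a • (x - z) + b • (y - z) = 0 := by
        have : a • (x - z) + b • (y - z) = z - (a + b) • z := by rw [hz]; module
        rw [this, hab]; simp
      rw [this, inner_zero_right]
    have h1' : w x ≤ w z + inner ℝ (V z) (x - z) := by
      have := mul_nonneg hε.le (sq_nonneg ‖x - z‖); linarith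
    have h2' : w y ≤ w z + inner ℝ (V z) (y - z) := by
      have := mul_nonneg hε.le (sq_nonneg ‖y - z‖); linarith
    have h3 := mul_le_mul_of_nonneg_left h1' ha
    have h4 := mul_le_mul_of_nonneg_left h2' hb
    have h5 : a * w z + b * w z = w z := by rw [← add_mul, hab, one_mul]
    simp only [smul_eq_mul]
    linarith
  have hcont : Continuous w := hconc.locallyLipschitz.continuous
  obtain ⟨D, hD⟩ : ∃ D, ∀ x, ‖x‖ ≤ R1 → D ≤ w x := by
    obtain ⟨D, hD⟩ := (isCompact_closedBall (0:E2) R1).bddBelow_image hcont.continuousOn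
    exact ⟨D, fun x hx => hD ⟨x, by simpa using hx, rfl⟩⟩
  refine ⟨min C D, fun c hc => ?_⟩
  have hset : {x | c < u x} = {x | c < w x} := by
    ext x
    simp only [mem_ofPred_eq]
    rcases le_total ‖x‖ R1 with h | h
    · have := hC x h
      have := hD x h
      have := lt_min_iff.1 hc
      constructor <;> intro _ <;> linarith
    · rw [hfar x h]
  rw [hset]
  refine ⟨?_, ?_, isOpen_lt continuous_const hcont⟩
  · rw [isBounded_iff_forall_norm_le]
    refine ⟨(‖V 0‖ + |w 0 - c|) / ε + 1, fun x hx => ?_⟩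
    have h := hw 0 x
    have h2 := real_inner_le_norm (V 0) (x - 0)
    rw [sub_zero] at h h2
    have hx' : c < w x := hx
    by_contra hlt
    push Not at hlt
    have h3 := le_abs_self (w 0 - c)
    have h4 : ‖V 0‖ + |w 0 - c| < ε * ‖x‖ := by
      have : (‖V 0‖ + |w 0 - c|) / ε < ‖x‖ := by linarith
      rw [div_lt_iff₀ hε] at this
      linarith
    have h5 : 1 ≤ ‖x‖ := by
      have : 0 ≤ (‖V 0‖ + |w 0 - c|) / ε := by positivity
      linarith
    have h6 := abs_nonneg (w 0 - c)
    nlinarith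
  · have := hconc.convex_gt c
    simpa using this
end
end

section
/- Let ω₀ ∈ L^∞(ℝ²) have compact support, let Ω < 0 satisfy Ω ≤ (1/2)·ess inf_{ℝ²} ω₀, and set u(x) = (N*ω₀)(x) + (Ω/2)|x|². For c ∈ ℝ such that the superlevel set {u > c} is bounded and contains the origin, define r_c = sup{r > 0 : B_r ⊆ {u > c}} and R_c = inf{r > 0 : {u > c} ⊆ B_r}, where B_r is the open disk of radius r centered at the origin. Then there exist constants C > 0 and δ₀ ∈ ℝ such that for every c < δ₀ one has that {u > c} is bounded and contains the origin and R_c ≤ r_c + C/r_c². -/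
open MeasureTheory Metric Set Filter

noncomputable section

/-- The inner radius `r_c` of the superlevel set `{u > c}`. -/
def innerRadius (u : E2 → ℝ) (c : ℝ) : ℝ :=
  sSup {r : ℝ | 0 < r ∧ ball (0 : E2) r ⊆ {x | c < u x}}

/-- The outer radius `R_c` of the superlevel set `{u > c}`. -/
def outerRadius (u : E2 → ℝ) (c : ℝ) : ℝ :=
  sInf {r : ℝ | 0 < r ∧ {x | c < u x} ⊆ ball (0 : E2) r}

/-- Purely radial comparison argument. -/
theorem radial_aux (u : E2 → ℝ) (g : ℝ → ℝ) (A K a B : ℝ) (hA : 1 ≤ A) (hK : 0 ≤ K) (ha : 0 < a)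
    (hB : ∀ x, ‖x‖ ≤ A → -B ≤ u x)
    (hug : ∀ x, A ≤ ‖x‖ → |u x - g ‖x‖| ≤ K / ‖x‖)
    (hg : ∀ s t, A ≤ s → s ≤ t → g t + a * s * (t - s) ≤ g s) :
    ∃ C > (0 : ℝ), ∃ δ₀ : ℝ, ∀ c < δ₀,
      Bornology.IsBounded {x | c < u x} ∧ c < u 0 ∧
      outerRadius u c ≤ innerRadius u c + C / (innerRadius u c) ^ 2 := by
  refine ⟨2 * K / a + 1, by positivity, -B, fun c hc => ?_⟩
  have hA0 : 0 < A := by linarith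
  have hbd : ∃ T, A ≤ T ∧ ∀ x, c < u x → ‖x‖ ≤ T := by
    refine ⟨A + |g A + K - c| / a, by have := abs_nonneg (g A + K - c); have : 0 ≤ |g A + K - c| / a := by positivity
                                      linarith, fun x hx => ?_⟩
    by_cases h : ‖x‖ ≤ A
    · have : 0 ≤ |g A + K - c| / a := by positivity
      linarith
    · push Not at h
      have h1 := (abs_le.1 (hug x h.le)).2
      have h2 := hg A ‖x‖ le_rfl h.le
      have h3 : K / ‖x‖ ≤ K := div_le_self hK (by linarith)
      have h4 : a * (‖x‖ - A) ≤ a * A * (‖x‖ - A) := by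
        have : 0 ≤ a * (‖x‖ - A) := mul_nonneg ha.le (by linarith)
        nlinarith
      have h5 := le_abs_self (g A + K - c)
      have : ‖x‖ - A ≤ |g A + K - c| / a := by
        rw [le_div_iff₀ ha]; nlinarith
      linarith
  obtain ⟨T, hAT, hT⟩ := hbd
  have hin : ∀ x, ‖x‖ ≤ A → c < u x := fun x hx => hc.trans_le (hB x hx)
  refine ⟨?_, hin 0 (by simpa using hA0.le), ?_⟩
  · refine (Metric.isBounded_closedBall (x := (0 : E2)) (r := T)).subset ?_
    intro x hx
    simpa using hT x hx
  set S := {r : ℝ | 0 < r ∧ ball (0 : E2) r ⊆ {x | c < u x}} with hS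
  have hAS : A ∈ S := ⟨hA0, fun x hx => hin x (by simpa using (mem_ball_zero_iff.1 hx).le)⟩
  have hSb : BddAbove S := by
    refine ⟨T + 1, fun r hr => ?_⟩
    by_contra hlt
    push Not at hlt
    obtain ⟨x, hx⟩ := exists_norm_eq E2 (show 0 ≤ T + 1 by linarith)
    have := hT x (hr.2 (by simpa [hx] using hlt))
    linarith
  have hr : innerRadius u c = sSup S := rfl
  rw [hr]
  set r := sSup S with hrdef
  have hAr : A ≤ r := le_csSup hSb hAS
  have hr0 : 0 < r := by linarith
  have hε : 0 < 1 / r ^ 2 := by positivity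
  have hex : ∃ x, r ≤ ‖x‖ ∧ ‖x‖ < r + 1 / r ^ 2 ∧ u x ≤ c := by
    have : r + 1 / r ^ 2 ∉ S := fun h => by
      have := le_csSup hSb h
      linarith
    have h2 : ¬ (ball (0 : E2) (r + 1 / r ^ 2) ⊆ {x | c < u x}) := fun h => this ⟨by positivity, h⟩
    obtain ⟨x, hx, hxu⟩ := Set.not_subset.1 h2
    simp only [mem_ofPred_eq, not_lt] at hxu
    refine ⟨x, ?_, by simpa using hx, hxu⟩
    by_contra hlt
    push Not at hlt
    obtain ⟨q, hq, hxq⟩ := exists_lt_of_lt_csSup ⟨A, hAS⟩ hlt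
    have := hq.2 (show x ∈ ball (0 : E2) q by simpa using hxq)
    simp only [mem_ofPred_eq] at this
    linarith
  obtain ⟨x, hrx, hxr, hxc⟩ := hex
  refine csInf_le ⟨0, fun q hq => hq.1.le⟩ ⟨by positivity, fun y hy => ?_⟩
  simp only [mem_ofPred_eq] at hy
  rw [mem_ball_zero_iff, add_div]
  have hC : 0 ≤ 2 * K / a / r ^ 2 := by positivity
  by_cases hyx : ‖y‖ ≤ ‖x‖
  · linarith
  push Not at hyx
  have hx0 : 0 < ‖x‖ := by linarith
  have h1 := (abs_le.1 (hug y (by linarith))).2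
  have h2 := (abs_le.1 (hug x (by linarith))).1
  have h3 := hg ‖x‖ ‖y‖ (by linarith) hyx.le
  have h4 : K / ‖y‖ ≤ K / r := by gcongr; linarith
  have h5 : K / ‖x‖ ≤ K / r := by gcongr
  have h6 : a * r * (‖y‖ - ‖x‖) ≤ a * ‖x‖ * (‖y‖ - ‖x‖) := by
    have : 0 ≤ ‖y‖ - ‖x‖ := by linarith
    gcongr
  have h7 : a * r * (‖y‖ - ‖x‖) < 2 * (K / r) := by linarith
  have h8 : ‖y‖ - ‖x‖ < 2 * K / a / r ^ 2 := by
    rw [div_div, lt_div_iff₀ (by positivity)]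
    have := mul_lt_mul_of_pos_right h7 hr0
    have e : 2 * (K / r) * r = 2 * K := by field_simp
    nlinarith
  linarith

theorem log_int_s14 (ρ : ℝ) : Integrable (fun z : E2 => (Iio ρ).indicator (fun r => Real.log r) ‖z‖) := by
  rw [integrable_fun_norm_addHaar volume (f := (Iio ρ).indicator (fun r => Real.log r))]
  have hd : Module.finrank ℝ E2 = 2 := by simp
  rw [hd]
  have h : IntegrableOn (fun r : ℝ => r * Real.log r) (Icc 0 ρ) :=
    Real.continuous_mul_log.continuousOn.integrableOn_Icc
  have h2 : IntegrableOn ((Iio ρ).indicator (fun r : ℝ => r * Real.log r)) (Ioi 0) := by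
    rw [IntegrableOn, integrable_indicator_iff measurableSet_Iio, IntegrableOn, Measure.restrict_restrict measurableSet_Iio]
    exact h.mono_set (fun r hr => ⟨hr.2.le, hr.1.le⟩)
  refine h2.congr (Eventually.of_forall fun r => ?_)
  by_cases hr : r < ρ <;> simp [hr]

theorem conv_int (ω : E2 → ℝ) (M : ℝ) (hmeas : Measurable ω) (hbound : ∀ x, |ω x| ≤ M) (R : ℝ)
    (hR : ∀ y, ω y ≠ 0 → ‖y‖ ≤ R) (A : ℝ) :
    ∃ B, ∀ x : E2, ‖x‖ ≤ A → Integrable (fun y => Real.log ‖x - y‖ * ω y) ∧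
      |∫ y, Real.log ‖x - y‖ * ω y| ≤ B := by
  set F := fun z : E2 => (Iio (A + R + 1)).indicator (fun r => Real.log r) ‖z‖ with hF
  have hFi : Integrable F := log_int_s14 _
  refine ⟨∫ z, |F z| * M, fun x hx => ?_⟩
  have hFx : Integrable (fun y => |F (x - y)| * M) := (hFi.abs.comp_sub_left x).mul_const M
  have hle : ∀ y, ‖Real.log ‖x - y‖ * ω y‖ ≤ |F (x - y)| * M := by
    intro y
    by_cases hy : ω y = 0
    · have := (abs_nonneg _).trans (hbound y)
      simp only [hy, mul_zero, norm_zero]; positivity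
    · have h1 := hR y hy
      have h2 := norm_sub_le x y
      have : F (x - y) = Real.log ‖x - y‖ := by
        simp only [hF]
        rw [indicator_of_mem]
        simp only [mem_Iio]; linarith
      rw [this, norm_mul, Real.norm_eq_abs, Real.norm_eq_abs]
      gcongr
      exact hbound y
  refine ⟨hFx.mono' (by fun_prop) (Eventually.of_forall hle), ?_⟩
  rw [← Real.norm_eq_abs]
  refine (norm_integral_le_of_norm_le hFx (Eventually.of_forall hle)).trans ?_
  exact (integral_sub_left_eq_self (fun z => |F z| * M) volume x).le

theorem log_aux (x y : E2) (R : ℝ) (hR : 0 < R) (hx : 2 * R ≤ ‖x‖) (hy : ‖y‖ ≤ R) :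
    |Real.log ‖x - y‖ - Real.log ‖x‖| ≤ 2 * R / ‖x‖ := by
  have hx0 : 0 < ‖x‖ := by linarith
  have h1 : ‖x‖ - R ≤ ‖x - y‖ := by have := norm_sub_norm_le x y; linarith
  have h2 : ‖x - y‖ ≤ ‖x‖ + R := (norm_sub_le x y).trans (by linarith)
  have h0 : 0 < ‖x - y‖ := by linarith
  rw [abs_le]
  constructor
  · have h := Real.log_le_sub_one_of_pos (div_pos hx0 h0)
    rw [Real.log_div hx0.ne' h0.ne'] at h
    have : ‖x‖ / ‖x - y‖ - 1 ≤ 2 * R / ‖x‖ := by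
      rw [div_sub_one h0.ne', div_le_div_iff₀ h0 hx0]
      nlinarith
    linarith
  · have h := Real.log_le_sub_one_of_pos (div_pos h0 hx0)
    rw [Real.log_div h0.ne' hx0.ne'] at h
    have : ‖x - y‖ / ‖x‖ - 1 ≤ 2 * R / ‖x‖ := by
      rw [div_sub_one hx0.ne']
      gcongr
      linarith
    linarith

/-- For `Ω < 0` with `Ω ≤ (1/2) ess inf ω₀`, the far-out superlevel sets of the stream
function `u = N*ω₀ + (Ω/2)|x|²` are bounded neighborhoods of the origin satisfying
`R_c ≤ r_c + C/r_c²` for a uniform constant `C`. -/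
theorem far_superlevel_sets_are_even_rounder_annuli
    (ω₀ : E2 → ℝ) (M : ℝ) (hmeas : Measurable ω₀) (hbound : ∀ x, |ω₀ x| ≤ M)
    (hsupp : HasCompactSupport ω₀)
    (Ω : ℝ) (hΩneg : Ω < 0) (hΩ : Ω ≤ (1 / 2) * essInf ω₀ volume)
    (u : E2 → ℝ) (hu : u = fun x => newtonConv ω₀ x + Ω / 2 * ‖x‖ ^ 2) :
    ∃ C > (0 : ℝ), ∃ δ₀ : ℝ, ∀ c < δ₀,
      Bornology.IsBounded {x | c < u x} ∧ c < u 0 ∧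
      outerRadius u c ≤ innerRadius u c + C / (innerRadius u c) ^ 2 := by
  have hpi := Real.pi_pos
  obtain ⟨R, hR0, hR⟩ : ∃ R, 0 < R ∧ ∀ y, ω₀ y ≠ 0 → ‖y‖ ≤ R := by
    obtain ⟨R, hR0, hR⟩ := hsupp.isCompact.isBounded.exists_pos_norm_le
    exact ⟨R, hR0, fun y hy => hR y (subset_tsupport _ hy)⟩
  have hN : ∀ x, newtonConv ω₀ x = -(1 / (2 * Real.pi)) * ∫ y, Real.log ‖x - y‖ * ω₀ y := by
    intro x
    rw [newtonConv, ← integral_const_mul]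
    congr 1
    ext y
    rw [NewtonianPotential, one_div ‖x - y‖, Real.log_inv]
    ring
  have hωi : Integrable ω₀ := by
    have hfi : Integrable ((closedBall (0 : E2) R).indicator fun _ => M) :=
      (integrable_indicator_iff measurableSet_closedBall).2
        (integrableOn_const (isCompact_closedBall _ _).measure_lt_top.ne)
    refine hfi.mono' hmeas.aestronglyMeasurable (Eventually.of_forall fun y => ?_)
    by_cases hy : ω₀ y = 0
    · rw [hy, norm_zero]
      exact indicator_nonneg (fun _ _ => (abs_nonneg _).trans (hbound y)) _
    · rw [indicator_of_mem (by simpa using hR y hy)]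
      exact hbound y
  set m := ∫ y, ω₀ y with hm
  set k := 1 / (2 * Real.pi) with hk
  have hk0 : 0 < k := by positivity
  set L := ∫ y, |ω₀ y| with hL
  have hL0 : 0 ≤ L := integral_nonneg fun _ => abs_nonneg _
  set A := 1 + 2 * R + k * |m| / (-Ω / 2) with hAdef
  have hΩ2 : 0 < -Ω / 2 := by linarith
  have hA3 : 0 ≤ k * |m| / (-Ω / 2) := by positivity
  have hA4 : k * |m| ≤ (-Ω / 2) * A := by
    have : k * |m| = (-Ω / 2) * (k * |m| / (-Ω / 2)) := (mul_div_cancel₀ _ hΩ2.ne').symm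
    rw [this, hAdef]
    gcongr
    linarith
  obtain ⟨B, hB⟩ := conv_int ω₀ M hmeas hbound R hR A
  refine radial_aux u (fun s => -(k * m) * Real.log s + Ω / 2 * s ^ 2) A (k * (2 * R * L)) (-Ω / 2)
    (k * B + -Ω / 2 * A ^ 2) (by linarith) (by positivity) hΩ2 ?_ ?_ ?_
  · intro x hx
    have h1 := (abs_le.1 (hB x hx).2).2
    rw [hu]
    simp only [hN]
    have h2 : k * (∫ y, Real.log ‖x - y‖ * ω₀ y) ≤ k * B := by gcongr
    have h3 : -Ω / 2 * ‖x‖ ^ 2 ≤ -Ω / 2 * A ^ 2 := by gcongr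
    linarith
  · intro x hx
    obtain ⟨_, hB'⟩ := conv_int ω₀ M hmeas hbound R hR ‖x‖
    have hi := (hB' x le_rfl).1
    have e : u x - (-(k * m) * Real.log ‖x‖ + Ω / 2 * ‖x‖ ^ 2)
        = -k * ∫ y, (Real.log ‖x - y‖ - Real.log ‖x‖) * ω₀ y := by
      simp only [sub_mul]
      rw [integral_sub hi (hωi.const_mul _), integral_const_mul, hu]
      simp only [hN]
      ring
    simp only [e]
    rw [abs_mul, abs_neg, abs_of_pos hk0, mul_div_assoc]
    gcongr
    have hle : ∀ y, ‖(Real.log ‖x - y‖ - Real.log ‖x‖) * ω₀ y‖ ≤ 2 * R / ‖x‖ * |ω₀ y| := by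
      intro y
      by_cases hy : ω₀ y = 0
      · simp [hy]
      · rw [norm_mul, Real.norm_eq_abs, Real.norm_eq_abs]
        gcongr
        exact log_aux x y R hR0 (by linarith) (hR y hy)
    have := norm_integral_le_of_norm_le (hωi.abs.const_mul (2 * R / ‖x‖)) (Eventually.of_forall hle)
    rw [integral_const_mul, Real.norm_eq_abs] at this
    refine this.trans (le_of_eq ?_)
    rw [hL]; ring
  · intro s t hs hst
    have hs1 : 1 ≤ s := by linarith
    have hs0 : 0 < s := by linarith
    have ht0 : 0 < t := by linarith
    have hlog0 : 0 ≤ Real.log t - Real.log s := by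
      have := Real.log_le_log hs0 hst
      linarith
    have hlog : Real.log t - Real.log s ≤ t - s := by
      have h := Real.log_le_sub_one_of_pos (div_pos ht0 hs0)
      rw [Real.log_div ht0.ne' hs0.ne', div_sub_one hs0.ne'] at h
      exact h.trans (div_le_self (by linarith) hs1)
    have h1 : -(k * m) * (Real.log t - Real.log s) ≤ (-Ω / 2 * A) * (t - s) := by
      calc -(k * m) * (Real.log t - Real.log s) ≤ k * |m| * (Real.log t - Real.log s) := by
            have : -(k * m) ≤ k * |m| := by
              have := neg_abs_le m
              nlinarith
            gcongr
        _ ≤ k * |m| * (t - s) := by gcongr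
        _ ≤ _ := by
            have : 0 ≤ t - s := by linarith
            gcongr
    have h2 : (-Ω / 2 * A) * (t - s) ≤ (-Ω / 2 * t) * (t - s) := by
      have : 0 ≤ t - s := by linarith
      gcongr
      linarith
    nlinarith
end
end
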